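/- arXiv:1306.4773 — 3 statements merged into one kernel-verified Lean document; each statement's English description precedes it below -/
import Mathlib

section
/- (Theorem 1, improved delay bound) If ρ = Σ_n r_n/C(n) ≤ 1, then the delay of every packet of the aggregate flow is bounded by D(j) = d(j) − a(j) ≤ Σ_n σ_n/C(n). -/
open scoped Classical BigOperators

/-- The departure time of packet `j` is the arrival time of the first packet of its busy period
plus the service times of the packets from that one up to `j`. -/
theorem exists_departure_eq_arrival_add_sum {a w d : ℕ → ℝ} (ha : 0 ≤ a 1) (hd0 : d 0 = 0)
    (hd : ∀ j, 1 ≤ j → d j = max (a j) (d (j - 1)) + w j) (j : ℕ) (hj : 1 ≤ j) :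
    ∃ i, 1 ≤ i ∧ i ≤ j ∧ d j = a i + ∑ k ∈ Finset.Icc i j, w k := by
  induction j, hj using Nat.le_induction with
  | base => exact ⟨1, le_rfl, le_rfl, by simp [hd 1 le_rfl, hd0, ha]⟩
  | succ j hj ih =>
    have hstep := hd (j + 1) (by omega)
    rw [Nat.add_sub_cancel] at hstep
    rcases le_total (d j) (a (j + 1)) with h | h
    · exact ⟨j + 1, by omega, le_rfl, by simp [hstep, h]⟩
    · obtain ⟨i, hi, hij, heq⟩ := ih
      refine ⟨i, hi, by omega, ?_⟩
      rw [hstep, max_eq_right h, heq, Finset.sum_Icc_succ_top (by omega), add_assoc]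

/-- Theorem 1 (improved delay bound): if `ρ = ∑ n, r n / C n ≤ 1`, the delay
of every packet of the aggregate flow is bounded by `∑ n, σ n / C n`. -/
theorem multiclass_fifo_improved_delay_bound
    (N : ℕ) (hN : 0 < N)
    (C : Fin N → ℝ) (hC : ∀ n, 0 < C n)
    (a l : ℕ → ℝ) (c : ℕ → Fin N)
    (ha0 : ∀ j, 0 ≤ a j) (hamono : Monotone a)
    (hl : ∀ j, 1 ≤ j → 0 < l j)
    (hfin : ∀ t : ℝ, {j : ℕ | a j ≤ t}.Finite)
    (d : ℕ → ℝ) (hd0 : d 0 = 0)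
    (hd : ∀ j, 1 ≤ j → d j = max (a j) (d (j - 1)) + l j / C (c j))
    (r σ : Fin N → ℝ) (hr : ∀ n, 0 ≤ r n) (hσ : ∀ n, 0 ≤ σ n)
    (harr : ∀ n : Fin N, ∀ s t : ℝ, 0 ≤ s → s ≤ t →
      (∑' j : ℕ, if 1 ≤ j ∧ c j = n ∧ s ≤ a j ∧ a j ≤ t then l j else 0)
        ≤ r n * (t - s) + σ n)
    (hρ : ∑ n, r n / C n ≤ 1) :
    ∀ j, 1 ≤ j → d j - a j ≤ ∑ n, σ n / C n := by
  intro j hj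
  obtain ⟨i, hi, hij, hdj⟩ :=
    exists_departure_eq_arrival_add_sum (w := fun k => l k / C (c k)) (ha0 1) hd0 hd j hj
  have hclass : ∀ n, (∑ k ∈ Finset.Icc i j, if c k = n then l k else 0)
      ≤ r n * (a j - a i) + σ n := by
    intro n
    refine le_trans ?_ (harr n (a i) (a j) (ha0 i) (hamono hij))
    have hsum : Summable fun k : ℕ =>
        if 1 ≤ k ∧ c k = n ∧ a i ≤ a k ∧ a k ≤ a j then l k else 0 := by
      refine summable_of_hasFiniteSupport ((hfin (a j)).subset fun k hk => ?_)
      by_contra h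
      exact hk (if_neg fun h' => h h'.2.2.2)
    refine le_trans (Finset.sum_le_sum fun k hk => ?_)
      (hsum.sum_le_tsum (Finset.Icc i j) fun k _ => ?_)
    · obtain ⟨hik, hkj⟩ := Finset.mem_Icc.mp hk
      simp [hi.trans hik, hamono hik, hamono hkj]
    · split_ifs with h
      · exact (hl k h.1).le
      · exact le_rfl
  have hsplit : ∑ k ∈ Finset.Icc i j, l k / C (c k)
      = ∑ n, (∑ k ∈ Finset.Icc i j, if c k = n then l k else 0) / C n := by
    simp_rw [Finset.sum_div]
    rw [Finset.sum_comm]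
    simp [ite_div]
  have hbound : ∑ k ∈ Finset.Icc i j, l k / C (c k)
      ≤ (∑ n, r n / C n) * (a j - a i) + ∑ n, σ n / C n := by
    rw [hsplit, Finset.sum_mul, ← Finset.sum_add_distrib]
    refine Finset.sum_le_sum fun n _ => ?_
    rw [div_mul_eq_mul_div, ← add_div]
    exact div_le_div_of_nonneg_right (hclass n) (hC n).le
  have hrate := mul_le_of_le_one_left (sub_nonneg.mpr (hamono hij)) hρ
  linarith
end

section
/- (Theorem 3, improved per-class guaranteed rate) Fix a class n. If ρ̄ = Σ_{m ≠ n} r_m/C(m) < 1, then the multiclass FIFO system is a Guaranteed Rate server to class n with rate R_n = (1 − ρ̄)·C(n) and error term E_n = Σ_{m ≠ n} σ_m/((1 − ρ̄)·C(m)); that is, every class-n packet i satisfies d^{n}(i) ≤ GRC^{n}_i(R_n) + E_n, where GRC^{n} is the guaranteed-rate clock of the class-n subsequence of packets. -/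
open scoped Classical BigOperators

/-- The departure time of a packet is governed by the start of its busy period. -/
lemma fifo_departure_le_busy_period {a w d : ℕ → ℝ} (ha1 : 0 ≤ a 1) (hd0 : d 0 = 0)
    (hd : ∀ j, 1 ≤ j → d j = max (a j) (d (j - 1)) + w j) {j : ℕ} (hj : 1 ≤ j) :
    ∃ k, 1 ≤ k ∧ k ≤ j ∧ d j ≤ a k + ∑ p ∈ Finset.Icc k j, w p := by
  induction j, hj using Nat.le_induction with
  | base =>
    refine ⟨1, le_rfl, le_rfl, ?_⟩
    rw [hd 1 le_rfl]
    simp [hd0, ha1]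
  | succ j hj ih =>
    obtain ⟨k, hk1, hkj, hk⟩ := ih
    rw [hd (j + 1) (by omega), Nat.add_sub_cancel]
    rcases le_total (a (j + 1)) (d j) with h | h
    · refine ⟨k, hk1, by omega, ?_⟩
      rw [max_eq_right h, Finset.sum_Icc_succ_top (by omega)]
      linarith
    · refine ⟨j + 1, by omega, le_rfl, ?_⟩
      rw [max_eq_left h]
      simp

/-- The guaranteed-rate clock of a subsequence dominates the arrival time of any packet `k` plus
the service time of the packets of the subsequence from `k` on. -/
lemma arrival_add_service_le_clock {a w G : ℕ → ℝ} {idx : ℕ → ℕ} {P : ℕ → Prop}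
    [DecidablePred P]
    (hamono : Monotone a) (hw : ∀ j, 1 ≤ j → 0 ≤ w j) (hidx : StrictMono idx)
    (hpos : ∀ i, 1 ≤ i → 1 ≤ idx i)
    (hsurj : ∀ j, 1 ≤ j → P j → ∃ i, 1 ≤ i ∧ idx i = j)
    (hG : ∀ i, 1 ≤ i → G i = max (a (idx i)) (G (i - 1)) + w (idx i))
    {k : ℕ} (hk : 1 ≤ k) (i : ℕ) (hi : 1 ≤ i) (hki : k ≤ idx i) :
    a k + ∑ p ∈ Finset.Icc k (idx i) with P p, w p ≤ G i := by
  induction i, hi using Nat.le_induction with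
  | base =>
    have hsub : {p ∈ Finset.Icc k (idx 1) | P p} ⊆ {idx 1} := by
      intro p hp
      simp only [Finset.mem_filter, Finset.mem_Icc, Finset.mem_singleton] at hp ⊢
      obtain ⟨q, hq, rfl⟩ := hsurj p (by omega) hp.2
      exact le_antisymm hp.1.2 (hidx.monotone hq)
    have hsum := Finset.sum_le_sum_of_subset_of_nonneg (f := w) hsub
      (fun p hp _ => by
        rw [Finset.mem_singleton] at hp
        exact hw p (hp ▸ hpos 1 le_rfl))
    rw [Finset.sum_singleton] at hsum
    rw [hG 1 le_rfl]
    exact add_le_add ((hamono hki).trans (le_max_left _ _)) hsum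
  | succ i hi ih =>
    have hwi := hw _ (hpos (i + 1) (by omega))
    have hsub : {p ∈ Finset.Icc k (idx (i + 1)) | P p} ⊆
        insert (idx (i + 1)) {p ∈ Finset.Icc k (idx i) | P p} := by
      intro p hp
      simp only [Finset.mem_filter, Finset.mem_Icc, Finset.mem_insert] at hp ⊢
      obtain ⟨q, hq, rfl⟩ := hsurj p (by omega) hp.2
      have hqi : q ≤ i + 1 := hidx.le_iff_le.mp hp.1.2
      rcases hqi.eq_or_lt with rfl | h
      · exact Or.inl rfl
      · exact Or.inr ⟨⟨hp.1.1, hidx.monotone (by omega)⟩, hp.2⟩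
    have hnot : idx (i + 1) ∉ {p ∈ Finset.Icc k (idx i) | P p} := by
      simp only [Finset.mem_filter, Finset.mem_Icc]
      have := hidx (Nat.lt_add_one i)
      omega
    have hsum := Finset.sum_le_sum_of_subset_of_nonneg (f := w) hsub
      (fun p hp _ => by
        simp only [Finset.mem_filter, Finset.mem_Icc, Finset.mem_insert] at hp
        rcases hp with rfl | hp
        · exact hwi
        · exact hw p (by omega))
    rw [Finset.sum_insert hnot] at hsum
    rw [hG (i + 1) (by omega), Nat.add_sub_cancel]
    rcases le_or_gt k (idx i) with h | h
    · have h1 := ih h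
      have h2 := le_max_right (a (idx (i + 1))) (G i)
      linarith
    · rw [Finset.Icc_eq_empty_of_lt h, Finset.filter_empty, Finset.sum_empty] at hsum
      have h1 := hamono hki
      have h2 := le_max_left (a (idx (i + 1))) (G i)
      linarith

/-- The total length of the class-`m` packets among packets `k, …, j` is at most the class-`m`
arrival in the time interval from `a k` to `a j`. -/
lemma sum_class_le_tsum_arrival {α : Type*} [DecidableEq α] {a l : ℕ → ℝ} {c : ℕ → α} (m : α)
    (hamono : Monotone a) (hl : ∀ j, 1 ≤ j → 0 ≤ l j)
    (hfin : ∀ t : ℝ, {j : ℕ | a j ≤ t}.Finite) {k j : ℕ} (hk : 1 ≤ k) :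
    ∑ p ∈ Finset.Icc k j with c p = m, l p ≤
      ∑' p : ℕ, if 1 ≤ p ∧ c p = m ∧ a k ≤ a p ∧ a p ≤ a j then l p else 0 := by
  have hsummable : Summable
      (fun p : ℕ => if 1 ≤ p ∧ c p = m ∧ a k ≤ a p ∧ a p ≤ a j then l p else 0) := by
    refine summable_of_hasFiniteSupport ((hfin (a j)).subset fun p hp => ?_)
    by_contra h
    exact hp (if_neg fun h' => h h'.2.2.2)
  refine le_trans (Finset.sum_le_sum fun p hp => ?_)
    (hsummable.sum_le_tsum {p ∈ Finset.Icc k j | c p = m} fun p _ => ?_)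
  · simp only [Finset.mem_filter, Finset.mem_Icc] at hp
    rw [if_pos ⟨by omega, hp.2, hamono hp.1.1, hamono hp.1.2⟩]
  · split_ifs with h
    · exact hl p h.1
    · exact le_rfl

/-- Theorem 3 (improved per-class guaranteed rate): if
`ρ̄ = ∑_{m ≠ n} r m / C m < 1`, the system is a GR server to class `n` with
rate `(1 - ρ̄) * C n` and error term `∑_{m ≠ n} σ m / ((1 - ρ̄) * C m)`.
The class-`n` flow is enumerated by the strictly increasing map `idx`. -/
theorem multiclass_fifo_improved_per_class_GR
    (N : ℕ) (hN : 0 < N)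
    (C : Fin N → ℝ) (hC : ∀ n, 0 < C n)
    (a l : ℕ → ℝ) (c : ℕ → Fin N)
    (ha0 : ∀ j, 0 ≤ a j) (hamono : Monotone a)
    (hl : ∀ j, 1 ≤ j → 0 < l j)
    (hfin : ∀ t : ℝ, {j : ℕ | a j ≤ t}.Finite)
    (d : ℕ → ℝ) (hd0 : d 0 = 0)
    (hd : ∀ j, 1 ≤ j → d j = max (a j) (d (j - 1)) + l j / C (c j))
    (r σ : Fin N → ℝ) (hr : ∀ m, 0 ≤ r m) (hσ : ∀ m, 0 ≤ σ m)
    (harr : ∀ m : Fin N, ∀ s t : ℝ, 0 ≤ s → s ≤ t →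
      (∑' j : ℕ, if 1 ≤ j ∧ c j = m ∧ s ≤ a j ∧ a j ≤ t then l j else 0)
        ≤ r m * (t - s) + σ m)
    (n : Fin N)
    (idx : ℕ → ℕ) (hidx_mono : StrictMono idx)
    (hidx_class : ∀ i, 1 ≤ i → 1 ≤ idx i ∧ c (idx i) = n)
    (hidx_surj : ∀ j, 1 ≤ j → c j = n → ∃ i, 1 ≤ i ∧ idx i = j)
    (GRCn : ℕ → ℝ) (hG0 : GRCn 0 = 0)
    (hG : ∀ i, 1 ≤ i → GRCn i = max (a (idx i)) (GRCn (i - 1))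
      + l (idx i) / ((1 - ∑ m ∈ Finset.univ.erase n, r m / C m) * C n))
    (hrhobar : ∑ m ∈ Finset.univ.erase n, r m / C m < 1) :
    ∀ i, 1 ≤ i → d (idx i) ≤ GRCn i
      + ∑ m ∈ Finset.univ.erase n,
          σ m / ((1 - ∑ m' ∈ Finset.univ.erase n, r m' / C m') * C m) := by
  intro i hi
  set ρ := ∑ m ∈ Finset.univ.erase n, r m / C m with hρ
  have hρ0 : 0 ≤ ρ := Finset.sum_nonneg fun m _ => div_nonneg (hr m) (hC m).le
  have hρ1 : 0 < 1 - ρ := by linarith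
  have hl0 : ∀ j, 1 ≤ j → 0 ≤ l j := fun j hj => (hl j hj).le
  have hw : ∀ j, 1 ≤ j → 0 ≤ l j / ((1 - ρ) * C n) := fun j hj =>
    div_nonneg (hl0 j hj) (mul_pos hρ1 (hC n)).le
  obtain ⟨hj1, -⟩ := hidx_class i hi
  obtain ⟨k, hk1, hkj, hdj⟩ :=
    fifo_departure_le_busy_period (w := fun j => l j / C (c j)) (ha0 1) hd0 hd hj1
  have hclock := arrival_add_service_le_clock (P := fun j => c j = n) hamono hw hidx_mono
    (fun i hi => (hidx_class i hi).1) hidx_surj hG hk1 i hi hkj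
  have hGa : a (idx i) ≤ GRCn i := by
    rw [hG i hi]
    linarith [le_max_left (a (idx i)) (GRCn (i - 1)), hw _ hj1]
  set L : Fin N → ℝ := fun m => ∑ p ∈ Finset.Icc k (idx i) with c p = m, l p with hL
  have hsplit : ∑ p ∈ Finset.Icc k (idx i), l p / C (c p) =
      L n / C n + ∑ m ∈ Finset.univ.erase n, L m / C m := by
    rw [Finset.add_sum_erase _ (fun m => L m / C m) (Finset.mem_univ n),
      ← Finset.sum_fiberwise _ c]
    refine Finset.sum_congr rfl fun m _ => ?_
    rw [hL, Finset.sum_div]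
    refine Finset.sum_congr rfl fun p hp => ?_
    rw [(Finset.mem_filter.mp hp).2]
  have hcross : ∑ m ∈ Finset.univ.erase n, L m / C m ≤
      ρ * (a (idx i) - a k) + ∑ m ∈ Finset.univ.erase n, σ m / C m := by
    rw [hρ, Finset.sum_mul, ← Finset.sum_add_distrib]
    refine Finset.sum_le_sum fun m _ => ?_
    have h := (sum_class_le_tsum_arrival m hamono hl0 hfin hk1).trans
      (harr m (a k) (a (idx i)) (ha0 k) (hamono hkj))
    calc L m / C m ≤ (r m * (a (idx i) - a k) + σ m) / C m :=
          div_le_div_of_nonneg_right h (hC m).le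
      _ = r m / C m * (a (idx i) - a k) + σ m / C m := by ring
  have hσle : ∑ m ∈ Finset.univ.erase n, σ m / C m ≤
      ∑ m ∈ Finset.univ.erase n, σ m / ((1 - ρ) * C m) :=
    Finset.sum_le_sum fun m _ => div_le_div_of_nonneg_left (hσ m) (mul_pos hρ1 (hC m))
      (mul_le_of_le_one_left (hC m).le (by linarith))
  have hown : L n / C n ≤ (1 - ρ) * (GRCn i - a k) := by
    have h : L n / C n / (1 - ρ) ≤ GRCn i - a k := by
      rw [← Finset.sum_div] at hclock
      change a k + L n / ((1 - ρ) * C n) ≤ GRCn i at hclock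
      rw [div_div, mul_comm (C n)]
      linarith
    rwa [div_le_iff₀ hρ1, mul_comm] at h
  have hprod : ρ * (a (idx i) - a k) ≤ ρ * (GRCn i - a k) :=
    mul_le_mul_of_nonneg_left (by linarith) hρ0
  linarith
end

section
/- (Normalized backlog bound, used in the proof of Theorem 2) If ρ = Σ_n r_n/C(n) ≤ 1, then at any time t the rate-normalized backlog satisfies Σ_n B_n(t)/C(n) ≤ Σ_n σ_n/C(n) + ρ·max_n (L_n/C(n)), where B_n(t) = A_n(t) − A_n*(t) is the backlog of class n at time t. -/
open scoped Classical BigOperators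

/-- Summing the per-class totals, each divided by its rate, regroups into a single sum of the
normalized lengths over any finite set of packets that contains all the counted ones. -/
theorem sum_tsum_class_div {N : ℕ} (C : Fin N → ℝ) (l : ℕ → ℝ) (c : ℕ → Fin N)
    (P : ℕ → Prop) [DecidablePred P] (F : Finset ℕ) (hF : ∀ j ∈ F, 1 ≤ j) (hP : ∀ j, 1 ≤ j → P j → j ∈ F) :
    ∑ n, (∑' j : ℕ, if 1 ≤ j ∧ c j = n ∧ P j then l j else 0) / C n =
      ∑ j ∈ F, if P j then l j / C (c j) else 0 := by
  have h : ∀ n, (∑' j : ℕ, if 1 ≤ j ∧ c j = n ∧ P j then l j else 0) / C n =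
      ∑ j ∈ F, if c j = n then (if P j then l j / C (c j) else 0) else 0 := by
    intro n
    rw [tsum_eq_sum (s := F) fun j hj => if_neg fun h => hj (hP j h.1 h.2.2), Finset.sum_div]
    refine Finset.sum_congr rfl fun j hj => ?_
    have := hF j hj
    by_cases hn : c j = n <;> by_cases hp : P j <;> simp [hn, hp, this]
  simp_rw [h]
  rw [Finset.sum_comm]
  simp

/-- Every departure time is the start of a busy period plus the work served since then. -/
theorem exists_busy_period_start {a w d : ℕ → ℝ} (ha0 : ∀ j, 0 ≤ a j) (hd0 : d 0 = 0)
    (hd : ∀ j, 1 ≤ j → d j = max (a j) (d (j - 1)) + w j) (k : ℕ) :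
    ∃ i, 1 ≤ i ∧ i ≤ k + 1 ∧ d (k + 1) = a i + ∑ j ∈ Finset.Ico i (k + 1), w j + w (k + 1) := by
  induction k with
  | zero =>
    refine ⟨1, le_rfl, le_rfl, ?_⟩
    have := hd 1 le_rfl
    simp_all
  | succ k ih =>
    have h := hd (k + 2) (by omega)
    rw [show k + 2 - 1 = k + 1 by omega] at h
    rcases le_total (d (k + 1)) (a (k + 2)) with hle | hle
    · exact ⟨k + 2, by omega, le_rfl, by simp [h, max_eq_left hle]⟩
    · obtain ⟨i, hi1, hik, hi⟩ := ih
      refine ⟨i, hi1, by omega, ?_⟩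
      rw [Finset.sum_Ico_succ_top hik, h, max_eq_right hle, hi]
      ring

/-- Normalized backlog bound (used in the proof of Theorem 2): if
`ρ = ∑ n, r n / C n ≤ 1`, then at any time `t` the rate-normalized backlog
satisfies `∑ n, B n t / C n ≤ ∑ n, σ n / C n + ρ * max_n (L n / C n)`. -/
theorem multiclass_fifo_normalized_backlog_bound
    (N : ℕ) (hN : 0 < N)
    (C : Fin N → ℝ) (hC : ∀ n, 0 < C n)
    (a l : ℕ → ℝ) (c : ℕ → Fin N)
    (ha0 : ∀ j, 0 ≤ a j) (hamono : Monotone a)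
    (hl : ∀ j, 1 ≤ j → 0 < l j)
    (L : Fin N → ℝ) (hL : ∀ n, 0 < L n)
    (hlen : ∀ j, 1 ≤ j → l j ≤ L (c j))
    (maxLC : ℝ) (hmaxLC : IsGreatest (Set.range fun n => L n / C n) maxLC)
    (hfin : ∀ t : ℝ, {j : ℕ | a j ≤ t}.Finite)
    (d : ℕ → ℝ) (hd0 : d 0 = 0)
    (hd : ∀ j, 1 ≤ j → d j = max (a j) (d (j - 1)) + l j / C (c j))
    (An Anstar : Fin N → ℝ → ℝ)
    (hAn : ∀ n t, An n t =
      ∑' j : ℕ, if 1 ≤ j ∧ c j = n ∧ a j ≤ t then l j else 0)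
    (hAnstar : ∀ n t, Anstar n t =
      ∑' j : ℕ, if 1 ≤ j ∧ c j = n ∧ d j ≤ t then l j else 0)
    (r σ : Fin N → ℝ) (hr : ∀ n, 0 ≤ r n) (hσ : ∀ n, 0 ≤ σ n)
    (harr : ∀ n : Fin N, ∀ s t : ℝ, 0 ≤ s → s ≤ t →
      (∑' j : ℕ, if 1 ≤ j ∧ c j = n ∧ s ≤ a j ∧ a j ≤ t then l j else 0)
        ≤ r n * (t - s) + σ n)
    (hρ : ∑ n, r n / C n ≤ 1) :
    ∀ t : ℝ, ∑ n, (An n t - Anstar n t) / C n ≤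
      ∑ n, σ n / C n + (∑ n, r n / C n) * maxLC := by
  intro t
  set w : ℕ → ℝ := fun j => l j / C (c j) with hw
  have hw0 : ∀ j, 1 ≤ j → 0 < w j := fun j hj => div_pos (hl j hj) (hC _)
  have hwL : ∀ j, 1 ≤ j → w j ≤ maxLC := fun j hj =>
    (div_le_div_of_nonneg_right (hlen j hj) (hC _).le).trans (hmaxLC.2 ⟨c j, rfl⟩)
  have hM : 0 ≤ maxLC := (hw0 1 le_rfl).le.trans (hwL 1 le_rfl)
  have hρ0 : 0 ≤ ∑ n, r n / C n := Finset.sum_nonneg fun n _ => div_nonneg (hr n) (hC n).le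
  have hσ0 : 0 ≤ ∑ n, σ n / C n := Finset.sum_nonneg fun n _ => div_nonneg (hσ n) (hC n).le
  have had : ∀ j, 1 ≤ j → a j ≤ d j := fun j hj => by
    rw [hd j hj]
    linarith [le_max_left (a j) (d (j - 1)), hw0 j hj]
  set F : Finset ℕ := (hfin t).toFinset.filter (1 ≤ ·) with hFdef
  have hF : ∀ j, j ∈ F ↔ a j ≤ t ∧ 1 ≤ j := fun j => by simp [hFdef]
  have hF1 : ∀ j ∈ F, 1 ≤ j := fun j hj => ((hF j).1 hj).2
  have hback : ∑ n, (An n t - Anstar n t) / C n = ∑ j ∈ F, if d j ≤ t then 0 else w j := by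
    simp_rw [sub_div, Finset.sum_sub_distrib, hAn, hAnstar]
    rw [sum_tsum_class_div C l c (a · ≤ t) F hF1 fun j hj h => (hF j).2 ⟨h, hj⟩,
      sum_tsum_class_div C l c (d · ≤ t) F hF1
        fun j hj h => (hF j).2 ⟨(had j hj).trans h, hj⟩, ← Finset.sum_sub_distrib]
    refine Finset.sum_congr rfl fun j hj => ?_
    rw [if_pos ((hF j).1 hj).1]
    split_ifs <;> simp [hw]
  rw [hback]
  by_cases hex : ∃ k, t < d (k + 1) ∧ k + 1 ∈ F
  swap
  · push Not at hex
    rw [Finset.sum_eq_zero]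
    · positivity
    · intro j hj
      obtain ⟨k, rfl⟩ := Nat.exists_eq_add_of_le' (hF1 j hj)
      exact if_pos (not_lt.1 fun h => hex k h hj)
  obtain ⟨htd, hkF⟩ := Nat.find_spec hex
  have hmin := fun m => Nat.find_min hex (m := m)
  generalize Nat.find hex = k at htd hkF hmin
  have hat := ((hF _).1 hkF).1
  obtain ⟨i, hi1, hik, hi⟩ := exists_busy_period_start ha0 hd0 hd k
  have hait : a i ≤ t := (hamono hik).trans hat
  have hA : ∑ j ∈ F, (if a i ≤ a j ∧ a j ≤ t then w j else 0) ≤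
      (∑ n, r n / C n) * (t - a i) + ∑ n, σ n / C n := by
    refine (sum_tsum_class_div C l c (fun j => a i ≤ a j ∧ a j ≤ t) F hF1
      fun j hj h => (hF j).2 ⟨h.2, hj⟩).symm.trans_le ?_
    rw [Finset.sum_mul, ← Finset.sum_add_distrib]
    refine Finset.sum_le_sum fun n _ => ?_
    rw [div_mul_eq_mul_div, ← add_div]
    exact div_le_div_of_nonneg_right (harr n (a i) t (ha0 i) hait) (hC n).le
  have hsub : Finset.Ico i (k + 1) ⊆ F := fun j hj => by
    rw [Finset.mem_Ico] at hj
    exact (hF j).2 ⟨(hamono hj.2.le).trans hat, hi1.trans hj.1⟩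
  have hsplit : ∑ j ∈ F, (if d j ≤ t then 0 else w j) + ∑ j ∈ Finset.Ico i (k + 1), w j ≤
      ∑ j ∈ F, (if a i ≤ a j ∧ a j ≤ t then w j else 0) := by
    rw [← Finset.inter_eq_right.2 hsub, ← Finset.sum_ite_mem, ← Finset.sum_add_distrib]
    refine Finset.sum_le_sum fun j hj => ?_
    have hj1 := hF1 j hj
    have hjt := ((hF j).1 hj).1
    have hwj := hw0 j hj1
    by_cases hdj : d j ≤ t
    · by_cases hji : j ∈ Finset.Ico i (k + 1)
      · simp [hdj, hji, hjt, hamono (Finset.mem_Ico.1 hji).1]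
      · simp only [hdj, hji, if_true, if_false, add_zero]
        split_ifs <;> linarith
    · have hkj : k + 1 ≤ j := by
        by_contra! hlt
        obtain ⟨m, rfl⟩ := Nat.exists_eq_add_of_le' hj1
        exact hmin m (by omega) ⟨not_le.1 hdj, hj⟩
      have hji : j ∉ Finset.Ico i (k + 1) := fun h => by
        have := (Finset.mem_Ico.1 h).2
        omega
      simp [hdj, hji, hjt, hamono (hik.trans hkj)]
  have hX : 0 ≤ ∑ j ∈ Finset.Ico i (k + 1), w j :=
    Finset.sum_nonneg fun j hj => (hw0 j (hi1.trans (Finset.mem_Ico.1 hj).1)).le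
  have hwk := hwL (k + 1) (by omega)
  have helapsed : t - a i ≤ ∑ j ∈ Finset.Ico i (k + 1), w j + maxLC := by
    change d (k + 1) = a i + ∑ j ∈ Finset.Ico i (k + 1), w j + w (k + 1) at hi
    linarith
  linarith [mul_le_mul_of_nonneg_left helapsed hρ0, mul_le_of_le_one_left hX hρ,
    mul_add (∑ n, r n / C n) (∑ j ∈ Finset.Ico i (k + 1), w j) maxLC]
end
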